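/- Let I ⊆ ℚ[X] = ℚ[x₁,…,x_n] be a radical ideal, let F ∈ ℚ[x_n] satisfy ⟨F⟩ = I ∩ ℚ[x_n], and assume deg(F) = dim_ℚ(ℚ[X]/I) (in particular this dimension is finite). Let F = F₁⋯F_s be the factorization of F into irreducible factors over ℚ. Then I = ⋂_{i=1}^{s} ⟨I, Fᵢ⟩, and the ideal ⟨I, Fᵢ⟩ is prime for each i = 1,…,s. -/

import Mathlib

open MvPolynomial

/-- An algebra map from `K[T]` whose kernel is generated by a polynomial of degree equal to the
dimension of the target is surjective. -/
lemma Polynomial.surjective_of_ker_eq_span_of_natDegree_eq_finrank {K A : Type*} [Field K]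
    [CommRing A] [Algebra K A] [Module.Finite K A] (f : Polynomial K →ₐ[K] A) {F : Polynomial K}
    (hker : RingHom.ker f = Ideal.span {F})
    (hdeg : F.natDegree = Module.finrank K A) : Function.Surjective f := by
  let g : (Polynomial K ⧸ RingHom.ker f) →ₐ[K] A := Ideal.kerLiftAlg f
  have hg : Function.Injective g := Ideal.kerLiftAlg_injective f
  have hfin : Module.Finite K (Polynomial K ⧸ RingHom.ker f) :=
    Module.Finite.of_injective g.toLinearMap hg
  have hrank : Module.finrank K (Polynomial K ⧸ RingHom.ker f) = Module.finrank K A := by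
    rw [← hdeg, hker]
    exact finrank_quotient_span_eq_natDegree
  have hsurj : Function.Surjective g :=
    (LinearMap.injective_iff_surjective_of_finrank_eq_finrank (f := g.toLinearMap) hrank).1 hg
  intro a
  obtain ⟨q, rfl⟩ := hsurj a
  obtain ⟨p, rfl⟩ := Ideal.Quotient.mk_surjective q
  exact ⟨p, (Ideal.kerLiftAlg_mk f p).symm⟩

/-- If `f : P → R` is surjective modulo `I`, and `p` is a prime element dividing a generator of
`f⁻¹(I)`, then `⟨I, f p⟩` is prime and `f⁻¹⟨I, f p⟩ = ⟨p⟩`. -/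
lemma Ideal.isPrime_sup_span_singleton_and_comap_eq {P R : Type*} [CommRing P] [CommRing R]
    (f : P →+* R) (I : Ideal R) {F p : P} (hF : I.comap f = Ideal.span {F})
    (hsurj : Function.Surjective ((Ideal.Quotient.mk I).comp f)) (hp : Prime p) (hpF : p ∣ F) :
    (I ⊔ Ideal.span {f p}).IsPrime ∧ (I ⊔ Ideal.span {f p}).comap f = Ideal.span {p} := by
  have hker : RingHom.ker ((Ideal.Quotient.mk I).comp f) ≤ Ideal.span {p} := by
    rw [← RingHom.comap_ker, Ideal.mk_ker, hF, Ideal.span_singleton_le_span_singleton]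
    exact hpF
  have heq : I ⊔ Ideal.span {f p} = ((Ideal.span {p}).map
      ((Ideal.Quotient.mk I).comp f)).comap (Ideal.Quotient.mk I) := by
    rw [← Ideal.map_map, Ideal.comap_map_of_surjective' _ Ideal.Quotient.mk_surjective,
      Ideal.mk_ker, Ideal.map_span, Set.image_singleton, sup_comm]
  have hprime : (Ideal.span {p}).IsPrime := (Ideal.span_singleton_prime hp.ne_zero).2 hp
  rw [heq]
  have := Ideal.map_isPrime_of_surjective hsurj hker
  refine ⟨Ideal.comap_isPrime _ _, ?_⟩
  rw [Ideal.comap_comap, Ideal.comap_map_of_surjective' _ hsurj, sup_eq_left.2 hker]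

/-- **Proposition.** Let `I ⊆ ℚ[x₁,…,xₙ]` be a radical ideal, `⟨F⟩ = I ∩ ℚ[xₙ]` with
`deg F = dim_ℚ ℚ[X]/I` (finite). If `F = F₁ ⋯ F_s` is the factorization of `F` into
irreducible factors over `ℚ`, then `I = ⋂ᵢ ⟨I, Fᵢ⟩` and each `⟨I, Fᵢ⟩` is prime.
The elimination ideal `I ∩ ℚ[xₙ]` is rendered as the preimage of `I` under the embedding
`ℚ[T] → ℚ[x₁,…,xₙ]`, `T ↦ xₙ`. -/
theorem statement1 (n s : ℕ) (I : Ideal (MvPolynomial (Fin (n + 1)) ℚ))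
    (hrad : I.IsRadical) (F : Polynomial ℚ)
    (hF : Ideal.comap (Polynomial.aeval (X (Fin.last n) : MvPolynomial (Fin (n + 1)) ℚ)) I
      = Ideal.span {F})
    (hfin : Module.Finite ℚ (MvPolynomial (Fin (n + 1)) ℚ ⧸ I))
    (hdeg : F.natDegree = Module.finrank ℚ (MvPolynomial (Fin (n + 1)) ℚ ⧸ I))
    (Fi : Fin s → Polynomial ℚ) (hirr : ∀ i, Irreducible (Fi i))
    (hfac : F = ∏ i, Fi i) :
    I = (⨅ i : Fin s,
        (I ⊔ Ideal.span {Polynomial.aeval (X (Fin.last n) : MvPolynomial (Fin (n + 1)) ℚ) (Fi i)})) ∧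
      ∀ i : Fin s,
        (I ⊔ Ideal.span {Polynomial.aeval (X (Fin.last n) : MvPolynomial (Fin (n + 1)) ℚ) (Fi i)}).IsPrime := by
  have hsurj := Polynomial.surjective_of_ker_eq_span_of_natDegree_eq_finrank
    ((Ideal.Quotient.mkₐ ℚ I).comp (Polynomial.aeval (X (Fin.last n))))
    (by
      rw [← hF]
      ext p
      simp [RingHom.mem_ker, Ideal.Quotient.eq_zero_iff_mem]) hdeg
  have key (i : Fin s) := Ideal.isPrime_sup_span_singleton_and_comap_eq
    (Polynomial.aeval (X (Fin.last n) : MvPolynomial (Fin (n + 1)) ℚ)).toRingHom I hF hsurj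
    (hirr i).prime (hfac ▸ Finset.dvd_prod_of_mem Fi (Finset.mem_univ i))
  refine ⟨le_antisymm (le_iInf fun i => le_sup_left) fun x hx => ?_, fun i => (key i).1⟩
  obtain ⟨f, hf⟩ := hsurj (Ideal.Quotient.mk I x)
  have hfx : Polynomial.aeval (X (Fin.last n)) f - x ∈ I := Ideal.Quotient.eq.1 hf
  have hdvd (i : Fin s) : Fi i ∣ f := by
    rw [← Ideal.mem_span_singleton, ← (key i).2]
    exact (Submodule.sub_mem_iff_left _ (Ideal.mem_iInf.1 hx i)).1
      (Ideal.mem_sup_left hfx)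
  have hpow : F ∣ f ^ s := by
    simpa [hfac] using Finset.prod_dvd_prod_of_dvd (s := Finset.univ) Fi (fun _ => f)
      fun i _ => hdvd i
  rw [← Ideal.mem_span_singleton, ← hF, Ideal.mem_comap, map_pow] at hpow
  exact (Submodule.sub_mem_iff_right _ (hrad ⟨s, hpow⟩)).1 hfx
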